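/- arXiv:2111.06238 — 4 statements merged into one kernel-verified Lean document; each statement's English description precedes it below -/
import Mathlib

section
/- Let (Ω, F, P) be a probability space with filtration (F_t)_{t∈ℕ} and let (Y_t)_{t≥1} be an adapted, integrable real-valued process such that there exists L > 0 with E[(Y_t − E[Y_t | F_{t−1}])²] ≤ L for all t ≥ 1. Then for every ε > 0, n^{1/2 − ε} · U_n(Y) → 0 P-almost surely as n → ∞, where U_n(Y) = (1/n) ∑_{t=1}^{n} (Y_t − E[Y_t | F_{t−1}]); that is, U_n(Y) = o(n^{−1/2 + ε}) almost surely. -/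
open MeasureTheory Filter Finset
open scoped ENNReal NNReal

/-- Kronecker's lemma. -/
lemma kronecker_aux (b S : ℕ → ℝ) (hb0 : b 0 = 0) (hmono : Monotone b)
    (hb : Tendsto b atTop atTop) (c : ℝ)
    (hS : Tendsto S atTop (nhds c)) :
    Tendsto (fun n => (b n)⁻¹ * ∑ i ∈ range n, b (i + 1) * (S (i + 1) - S i)) atTop (nhds 0) := by
  have key : ∀ n, ∑ i ∈ range n, b (i + 1) * (S (i + 1) - S i)
      = b n * (S n - c) - ∑ i ∈ range n, (b (i + 1) - b i) * (S i - c) := by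
    intro n
    induction n with
    | zero => simp [hb0]
    | succ n ih => rw [sum_range_succ, sum_range_succ, ih]; ring
  have hsum : ∀ n, ∑ i ∈ range n, (b (i + 1) - b i) = b n := by
    intro n; rw [sum_range_sub, hb0, sub_zero]
  have hSc : Tendsto (fun n => S n - c) atTop (nhds 0) := by
    simpa using hS.sub_const c
  have hlo : (fun i => (b (i + 1) - b i) * (S i - c)) =o[atTop] (fun i => b (i + 1) - b i) := by
    have := (Asymptotics.isBigO_refl (fun i => b (i + 1) - b i) atTop).mul_isLittleO
      ((Asymptotics.isLittleO_one_iff ℝ).2 hSc)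
    simpa using this
  have h2 := hlo.sum_range (fun i => sub_nonneg.2 (hmono (Nat.le_succ i))) (by simpa only [hsum] using hb)
  simp only [hsum] at h2
  have h3 := h2.tendsto_div_nhds_zero
  have h4 := hSc.sub h3
  rw [sub_zero] at h4
  refine h4.congr' ?_
  filter_upwards [hb.eventually_gt_atTop 0] with n hn
  rw [key]
  field_simp

/-- Martingale differences with summable variances have a.s. convergent partial sums. -/
lemma conv_aux {Ω : Type*} {m0 : MeasurableSpace Ω} (μ : Measure Ω) [IsProbabilityMeasure μ]
    (ℱ : Filtration ℕ m0) (D : ℕ → Ω → ℝ)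
    (hadp : ∀ t, StronglyMeasurable[ℱ (t + 1)] (D t)) (hL2 : ∀ t, MemLp (D t) 2 μ)
    (hcond : ∀ t, μ[D t | ℱ t] =ᵐ[μ] 0) (v : ℕ → ℝ) (hv : Summable v)
    (hDv : ∀ t, ∫ ω, D t ω ^ 2 ∂μ ≤ v t) :
    ∀ᵐ ω ∂μ, ∃ c, Tendsto (fun n => ∑ t ∈ range n, D t ω) atTop (nhds c) := by
  set M : ℕ → Ω → ℝ := fun n ω => ∑ t ∈ range n, D t ω with hM
  have hMs : ∀ n, M (n + 1) = M n + D n := by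
    intro n; funext ω; simp [hM, sum_range_succ]
  have hM0 : M 0 = 0 := by funext ω; simp [hM]
  have hMad : StronglyAdapted ℱ M := by
    intro n
    induction n with
    | zero => rw [hM0]; exact stronglyMeasurable_zero
    | succ n ih => rw [hMs]; exact (ih.mono (ℱ.mono (Nat.le_succ n))).add (hadp n)
  have hML2 : ∀ n, MemLp (M n) 2 μ := by
    intro n
    induction n with
    | zero => rw [hM0]; exact MemLp.zero
    | succ n ih => rw [hMs]; exact ih.add (hL2 n)
  have hDint : ∀ n, Integrable (D n) μ := fun n => (hL2 n).integrable one_le_two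
  have hMint : ∀ n, Integrable (M n) μ := fun n => (hML2 n).integrable one_le_two
  have hmart : Martingale M ℱ μ := by
    refine martingale_of_condExp_sub_eq_zero_nat hMad hMint fun i => ?_
    have : M (i + 1) - M i = D i := by rw [hMs]; simp
    rw [this]; exact hcond i
  have horth : ∀ n, ∫ ω, M n ω * D n ω ∂μ = 0 := by
    intro n
    have hint : Integrable (M n * D n) μ := (hML2 n).integrable_mul (hL2 n)
    have h1 := condExp_mul_of_stronglyMeasurable_left (hMad n) hint (hDint n)
    have h2 : μ[M n * D n | ℱ n] =ᵐ[μ] 0 := by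
      filter_upwards [h1, hcond n] with ω a b
      rw [a]; simp [b]
    have h3 := integral_condExp (μ := μ) (f := M n * D n) (ℱ.le n)
    rw [integral_congr_ae h2] at h3
    simpa using h3.symm
  have hsq : ∀ n, ∫ ω, M n ω ^ 2 ∂μ ≤ ∑ t ∈ range n, v t := by
    intro n
    induction n with
    | zero => simp [hM0]
    | succ n ih =>
      have e : ∀ ω, M (n + 1) ω ^ 2 = M n ω ^ 2 + (2 * (M n ω * D n ω) + D n ω ^ 2) := by
        intro ω; rw [hMs]; simp only [Pi.add_apply]; ring
      have i1 := (hML2 n).integrable_sq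
      have i2 := (hL2 n).integrable_sq
      have i3 : Integrable (fun ω => 2 * (M n ω * D n ω)) μ :=
        ((hML2 n).integrable_mul (hL2 n)).const_mul 2
      have i4 : Integrable (fun ω => 2 * (M n ω * D n ω) + D n ω ^ 2) μ := i3.add i2
      simp_rw [e]
      rw [integral_add i1 i4, integral_add i3 i2, integral_const_mul, horth, sum_range_succ]
      linarith [hDv n]
  have hvnn : ∀ t, 0 ≤ v t := fun t => (integral_nonneg fun ω => sq_nonneg _).trans (hDv t)
  refine hmart.submartingale.exists_ae_tendsto_of_bdd (R := (1 + ∑' t, v t).toNNReal) fun n => ?_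
  rw [eLpNorm_one_eq_lintegral_enorm, ← ofReal_integral_norm_eq_lintegral_enorm (hMint n)]
  refine ENNReal.ofReal_le_ofReal ?_
  calc ∫ ω, ‖M n ω‖ ∂μ ≤ ∫ ω, (1 + M n ω ^ 2) ∂μ := by
        refine integral_mono (hMint n).norm ((integrable_const 1).add (hML2 n).integrable_sq) ?_
        intro ω
        simp only [Real.norm_eq_abs]
        nlinarith [sq_abs (M n ω), sq_nonneg (|M n ω| - 1), abs_nonneg (M n ω)]
    _ = 1 + ∫ ω, M n ω ^ 2 ∂μ := by
        rw [integral_add (integrable_const 1) (hML2 n).integrable_sq]; simp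
    _ ≤ 1 + ∑' t, v t := by
        linarith [hsq n, hv.sum_le_tsum (range n) (fun t _ => hvnn t)]

/-- Convergence rate of the additive long-run law: for every ε > 0,
`n^{1/2 - ε} · U_n(Y) → 0` almost surely. -/
theorem long_run_law_additive_rate
    {Ω : Type*} {m0 : MeasurableSpace Ω} (μ : Measure Ω) [IsProbabilityMeasure μ]
    (ℱ : Filtration ℕ m0) (Y : ℕ → Ω → ℝ)
    (hadp : Adapted ℱ Y) (hint : ∀ t, Integrable (Y t) μ)
    (L : ℝ) (hL : 0 < L)
    (hvar : ∀ t, 1 ≤ t →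
      ∫⁻ ω, (‖Y t ω - (μ[Y t | ℱ (t - 1)]) ω‖₊ : ℝ≥0∞) ^ 2 ∂μ ≤ ENNReal.ofReal L)
    (ε : ℝ) (hε : 0 < ε) :
    ∀ᵐ ω ∂μ, Tendsto
      (fun n : ℕ => (n : ℝ) ^ ((1 : ℝ) / 2 - ε) *
        ((1 / (n : ℝ)) * ∑ t ∈ Finset.Icc 1 n, (Y t ω - (μ[Y t | ℱ (t - 1)]) ω)))
      atTop (nhds 0) := by
  set a : ℝ := 1 / 2 + ε with ha
  have ha0 : 0 < a := by positivity
  set X : ℕ → Ω → ℝ := fun t => Y (t + 1) - μ[Y (t + 1) | ℱ t] with hX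
  have hXm : ∀ t, StronglyMeasurable[ℱ (t + 1)] (X t) := fun t =>
    (hadp.stronglyAdapted (t + 1)).sub (stronglyMeasurable_condExp.mono (ℱ.mono (Nat.le_succ t)))
  have hXae : ∀ t, AEStronglyMeasurable (X t) μ := fun t =>
    ((hXm t).mono (ℱ.le _)).aestronglyMeasurable
  have hXv : ∀ t, ∫⁻ ω, ‖X t ω‖ₑ ^ 2 ∂μ ≤ ENNReal.ofReal L := fun t =>
    hvar (t + 1) (Nat.le_add_left 1 t)
  have hXL2 : ∀ t, MemLp (X t) 2 μ := by
    intro t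
    refine ⟨hXae t, ?_⟩
    rw [eLpNorm_lt_top_iff_lintegral_rpow_enorm_lt_top (by simp) (by simp)]
    refine lt_of_le_of_lt ?_ ((hXv t).trans_lt ENNReal.ofReal_lt_top)
    simp
  have hXsq : ∀ t, ∫ ω, X t ω ^ 2 ∂μ ≤ L := by
    intro t
    rw [integral_eq_lintegral_of_nonneg_ae (ae_of_all _ fun ω => sq_nonneg _)
      ((hXae t).pow 2)]
    refine ENNReal.toReal_le_of_le_ofReal hL.le (le_trans (le_of_eq ?_) (hXv t))
    refine lintegral_congr fun ω => ?_
    rw [← sq_abs, ENNReal.ofReal_pow (abs_nonneg _), Real.enorm_eq_ofReal_abs]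
  have hXc : ∀ t, μ[X t | ℱ t] =ᵐ[μ] 0 := by
    intro t
    have h1 := condExp_sub (hint (t + 1)) (integrable_condExp (μ := μ) (m := ℱ t) (f := Y (t + 1))) (ℱ t)
    refine h1.trans ?_
    rw [condExp_of_stronglyMeasurable (ℱ.le t) stronglyMeasurable_condExp integrable_condExp]
    simp
  set b : ℕ → ℝ := fun n => (n : ℝ) ^ a with hb
  have hbpos : ∀ t, 0 < b (t + 1) := fun t => by
    simp only [hb]; positivity
  have hsummable : Summable (fun t : ℕ => ((b (t + 1))⁻¹) ^ 2 * L) := by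
    refine Summable.mul_right L ?_
    have h1 : Summable (fun n : ℕ => ((n : ℝ) ^ (2 * a))⁻¹) :=
      Real.summable_nat_rpow_inv.2 (by rw [ha]; linarith)
    refine ((summable_nat_add_iff 1).2 h1).congr fun t => ?_
    simp only [hb]
    rw [inv_pow, ← Real.rpow_natCast, ← Real.rpow_mul (by positivity)]
    norm_num [mul_comm]
  have hconv := conv_aux μ ℱ (fun t => (b (t + 1))⁻¹ • X t)
    (fun t => (hXm t).const_smul _) (fun t => (hXL2 t).const_smul _)
    (fun t => by
      refine (condExp_smul _ _ _).trans ?_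
      filter_upwards [hXc t] with ω h
      simp [h]) _ hsummable
    (fun t => by
      simp only [Pi.smul_apply, smul_eq_mul, mul_pow]
      rw [integral_const_mul]
      exact mul_le_mul_of_nonneg_left (hXsq t) (sq_nonneg _))
  filter_upwards [hconv] with ω hω
  obtain ⟨c, hc⟩ := hω
  have hk := kronecker_aux b _ (by simp [hb, ha0.ne'])
    (fun m n h => Real.rpow_le_rpow (by positivity) (by exact_mod_cast h) ha0.le)
    ((tendsto_rpow_atTop ha0).comp tendsto_natCast_atTop_atTop) c hc
  refine hk.congr' ?_
  filter_upwards [eventually_gt_atTop 0] with n hn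
  have hn' : (0 : ℝ) < n := by exact_mod_cast hn
  have e1 : (b n)⁻¹ = (n : ℝ) ^ ((1 : ℝ) / 2 - ε) * (1 / (n : ℝ)) := by
    simp only [hb]
    rw [← Real.rpow_neg hn'.le, one_div (n : ℝ), ← Real.rpow_neg_one (n : ℝ), ← Real.rpow_add hn']
    congr 1; rw [ha]; ring
  rw [e1, mul_assoc]
  congr 2
  rw [← Finset.Ico_add_one_right_eq_Icc, Finset.sum_Ico_eq_sum_range]
  refine Finset.sum_congr (by simp) fun t _ => ?_
  rw [sum_range_succ, add_sub_cancel_left, Pi.smul_apply, smul_eq_mul,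
    mul_inv_cancel_left₀ (hbpos t).ne']
  simp [hX, add_comm]
end

section
/- Let (Ω, F, P) be a probability space with filtration (F_t)_{t∈ℕ} and let (Y_t)_{t≥1} be an adapted, integrable real-valued process such that there exists L > 0 with E[(Y_t − E[Y_t | F_{t−1}])²] ≤ L for all t ≥ 1. Then for any fixed a with 0 < a ≤ 1, the exponentially weighted average of shocks converges to zero almost surely: (1/n) ∑_{t=1}^{n} a^{n−t} (Y_t − E[Y_t | F_{t−1}]) → 0 P-almost surely as n → ∞. -/
open MeasureTheory Filter Finset
open scoped ENNReal NNReal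

lemma det_weighted (x : ℕ → ℝ) (a m : ℝ) (ha0 : 0 < a) (ha1 : a ≤ 1)
    (h : Tendsto (fun n : ℕ => ∑ t ∈ range n, (1 / ((t : ℝ) + 1)) * x (t + 1)) atTop (nhds m)) :
    Tendsto (fun n : ℕ => (1 / (n : ℝ)) * ∑ t ∈ Icc 1 n, a ^ (n - t) * x t) atTop (nhds 0) := by
  set N : ℕ → ℝ := fun n => (∑ t ∈ range n, (1 / ((t : ℝ) + 1)) * x (t + 1)) - m with hN
  set W : ℕ → ℝ := fun n => ∑ t ∈ Icc 1 n, a ^ (n - t) * x t with hW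
  have hN0 : Tendsto N atTop (nhds 0) := by
    simpa [hN] using h.sub_const m
  have hNs : ∀ n : ℕ, ((n : ℝ) + 1) * (N (n + 1) - N n) = x (n + 1) := by
    intro n
    simp only [hN, sum_range_succ]
    have : (n : ℝ) + 1 ≠ 0 := by positivity
    field_simp
    ring
  have hWs : ∀ n, W (n + 1) = a * W n + x (n + 1) := by
    intro n
    simp only [hW]
    rw [sum_Icc_succ_top (by omega), mul_sum]
    congr 1
    · refine sum_congr rfl fun t ht => ?_
      rw [mem_Icc] at ht
      rw [Nat.succ_sub ht.2, pow_succ]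
      ring
    · simp
  have key : ∀ ε > 0, ∃ n0 : ℕ, ∃ C : ℝ, ∀ n ≥ n0, |W n - n * N n| ≤ C + ε * n := by
    intro ε hε
    obtain ⟨n0, hn0⟩ := Metric.tendsto_atTop.1 hN0 ε hε
    refine ⟨n0, |W n0 - n0 * N n0|, fun n hn => ?_⟩
    induction n, hn using Nat.le_induction with
    | base => have : 0 ≤ ε * (n0 : ℝ) := by positivity
              linarith
    | succ n hn ih =>
      have h1 : W (n + 1) - ((n + 1 : ℕ) : ℝ) * N (n + 1)
          = a * (W n - n * N n) - ((1 - a) * n + 1) * N n := by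
        rw [hWs, ← hNs]; push_cast; ring
      have h2 : |N n| ≤ ε := by
        have := hn0 n hn
        rw [Real.dist_eq, sub_zero] at this
        exact this.le
      have h3 : 0 ≤ (1 - a) * n + 1 := by
        have : 0 ≤ 1 - a := by linarith
        positivity
      rw [h1]
      refine (abs_sub _ _).trans ?_
      rw [abs_mul, abs_mul, abs_of_pos ha0, abs_of_nonneg h3]
      have h4 := mul_le_mul_of_nonneg_left ih ha0.le
      have h5 := mul_le_mul_of_nonneg_left h2 h3
      have h6 := mul_le_mul_of_nonneg_right ha1 (abs_nonneg (W n0 - n0 * N n0))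
      push_cast
      nlinarith
  have hZ : Tendsto (fun n : ℕ => (1 / (n : ℝ)) * (W n - n * N n)) atTop (nhds 0) := by
    rw [Metric.tendsto_atTop]
    intro ε hε
    obtain ⟨n0, C, hC⟩ := key (ε / 2) (by positivity)
    obtain ⟨n1, hn1⟩ := exists_nat_gt (C / (ε / 2))
    refine ⟨max (max n0 n1) 1, fun n hn => ?_⟩
    have a1 : n0 ≤ n := by omega
    have a2 : n1 ≤ n := by omega
    have a3 : (0 : ℝ) < n := by exact_mod_cast (by omega : 0 < n)
    have a4 : (n1 : ℝ) ≤ n := by exact_mod_cast a2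
    have a5 := hC n a1
    have a6 : C < n * (ε / 2) := by
      rw [← div_lt_iff₀ (by positivity)]; linarith
    rw [Real.dist_eq, sub_zero, abs_mul, abs_of_pos (by positivity : 0 < 1 / (n : ℝ)),
      one_div, inv_mul_lt_iff₀ a3]
    linarith
  have := hZ.add hN0
  rw [add_zero] at this
  refine this.congr' ?_
  filter_upwards [eventually_ge_atTop 1] with n hn
  have a3 : (n : ℝ) ≠ 0 := by exact_mod_cast (by omega : n ≠ 0)
  field_simp
  ring



/-- Weighted long-run law of unexpected shocks: for `0 < a ≤ 1`, the exponentially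
weighted average of shocks `(1/n) ∑_{t=1}^n a^{n-t} (Y_t - E[Y_t | F_{t-1}])`
converges to zero almost surely. -/
theorem long_run_law_weighted
    {Ω : Type*} {m0 : MeasurableSpace Ω} (μ : Measure Ω) [IsProbabilityMeasure μ]
    (ℱ : Filtration ℕ m0) (Y : ℕ → Ω → ℝ)
    (hadp : Adapted ℱ Y) (hint : ∀ t, Integrable (Y t) μ)
    (L : ℝ) (hL : 0 < L)
    (hvar : ∀ t, 1 ≤ t →
      ∫⁻ ω, (‖Y t ω - (μ[Y t | ℱ (t - 1)]) ω‖₊ : ℝ≥0∞) ^ 2 ∂μ ≤ ENNReal.ofReal L)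
    (a : ℝ) (ha0 : 0 < a) (ha1 : a ≤ 1) :
    ∀ᵐ ω ∂μ, Tendsto
      (fun n : ℕ => (1 / (n : ℝ)) *
        ∑ t ∈ Finset.Icc 1 n, a ^ (n - t) * (Y t ω - (μ[Y t | ℱ (t - 1)]) ω))
      atTop (nhds 0) := by

  set X : ℕ → Ω → ℝ := fun t ω => Y t ω - (μ[Y t | ℱ (t - 1)]) ω with hX
  have hXm : ∀ t, StronglyMeasurable[ℱ t] (X t) := fun t =>
    (hadp t).stronglyMeasurable.sub
      (stronglyMeasurable_condExp.mono (ℱ.mono (Nat.sub_le t 1)))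
  have hXint : ∀ t, Integrable (X t) μ := fun t => (hint t).sub integrable_condExp
  have hXae : ∀ t, AEStronglyMeasurable (X t) μ := fun t => (hXint t).aestronglyMeasurable
  have hlin : ∀ t, ∫⁻ ω, ENNReal.ofReal (X t ω ^ 2) ∂μ
      = ∫⁻ ω, (‖Y t ω - (μ[Y t | ℱ (t - 1)]) ω‖₊ : ℝ≥0∞) ^ 2 ∂μ := by
    intro t
    refine lintegral_congr fun ω => ?_
    have h1 : (‖X t ω‖₊ : ℝ≥0∞) = ENNReal.ofReal |X t ω| := by
      rw [← Real.norm_eq_abs, ofReal_norm]; rfl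
    change ENNReal.ofReal (X t ω ^ 2) = (‖X t ω‖₊ : ℝ≥0∞) ^ 2
    rw [h1, ← ENNReal.ofReal_pow (abs_nonneg _), sq_abs]
  have hXsq : ∀ t, 1 ≤ t → Integrable (fun ω => X t ω ^ 2) μ := by
    intro t ht
    refine ⟨(hXae t).pow 2, ?_⟩
    rw [hasFiniteIntegral_iff_ofReal (ae_of_all _ fun ω => sq_nonneg _), hlin]
    exact (hvar t ht).trans_lt ENNReal.ofReal_lt_top
  have hXL : ∀ t, 1 ≤ t → ∫ ω, X t ω ^ 2 ∂μ ≤ L := by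
    intro t ht
    rw [← ENNReal.ofReal_le_ofReal_iff hL.le,
      ofReal_integral_eq_lintegral_ofReal (hXsq t ht) (ae_of_all _ fun ω => sq_nonneg _), hlin]
    exact hvar t ht
  have hX2 : ∀ t, 1 ≤ t → MemLp (X t) 2 μ := fun t ht =>
    (memLp_two_iff_integrable_sq (hXae t)).2 (hXsq t ht)
  have hXc : ∀ t, μ[X (t + 1) | ℱ t] =ᵐ[μ] 0 := by
    intro t
    have h1 : μ[X (t + 1) | ℱ t] =ᵐ[μ] μ[Y (t + 1) | ℱ t] - μ[μ[Y (t + 1) | ℱ t] | ℱ t] :=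
      condExp_sub (hint (t + 1)) integrable_condExp _
    rw [condExp_of_stronglyMeasurable (ℱ.le t) stronglyMeasurable_condExp integrable_condExp,
      sub_self] at h1
    exact h1
  set f : ℕ → Ω → ℝ := fun n ω => ∑ t ∈ range n, (1 / ((t : ℝ) + 1)) * X (t + 1) ω with hf
  have hfs : ∀ n, f (n + 1) = fun ω => f n ω + (1 / ((n : ℝ) + 1)) * X (n + 1) ω := by
    intro n; ext ω; simp only [hf, sum_range_succ]
  have hf0 : f 0 = fun _ => 0 := by ext ω; simp [hf]
  have hfm : ∀ n, StronglyMeasurable[ℱ n] (f n) := by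
    intro n
    induction n with
    | zero => rw [hf0]; exact stronglyMeasurable_const
    | succ n ih =>
      rw [hfs]
      exact (ih.mono (ℱ.mono (Nat.le_succ n))).add ((hXm (n + 1)).const_mul _)
  have hf2 : ∀ n, MemLp (f n) 2 μ := by
    intro n
    induction n with
    | zero => rw [hf0]; exact memLp_const 0
    | succ n ih =>
      rw [hfs]
      exact ih.add ((hX2 (n + 1) (by omega)).const_mul _)
  have hfint : ∀ n, Integrable (f n) μ := fun n => (hf2 n).integrable (by norm_num)
  have hmart : Martingale f ℱ μ := by
    refine martingale_of_condExp_sub_eq_zero_nat hfm hfint fun n => ?_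
    have h1 : f (n + 1) - f n = (1 / ((n : ℝ) + 1)) • X (n + 1) := by
      ext ω; simp [hfs]
    rw [h1]
    filter_upwards [condExp_smul (1 / ((n : ℝ) + 1)) (X (n + 1)) (ℱ n) (μ := μ), hXc n]
      with ω h2 h3
    rw [h2, Pi.smul_apply, h3]; simp
  have hcross : ∀ n, Integrable (fun ω => f n ω * X (n + 1) ω) μ := fun n =>
    (hf2 n).integrable_mul (hX2 (n + 1) (by omega))
  have hcross0 : ∀ n, ∫ ω, f n ω * X (n + 1) ω ∂μ = 0 := by
    intro n
    have h1 := condExp_mul_of_stronglyMeasurable_left (hfm n) (hcross n) (hXint (n + 1))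
    have h2 : μ[f n * X (n + 1) | ℱ n] =ᵐ[μ] 0 := by
      filter_upwards [h1, hXc n] with ω h3 h4
      rw [h3, Pi.mul_apply, h4]; simp
    have h5 := integral_condExp (μ := μ) (ℱ.le n) (f := f n * X (n + 1))
    rw [integral_congr_ae h2] at h5
    simpa using h5.symm
  have hfsq : ∀ n, ∫ ω, f n ω ^ 2 ∂μ ≤ L * ∑ t ∈ range n, 1 / ((t : ℝ) + 1) ^ 2 := by
    intro n
    induction n with
    | zero => simp [hf0]
    | succ n ih =>
      set c : ℝ := 1 / ((n : ℝ) + 1) with hc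
      have e1 : ∀ ω, f (n + 1) ω ^ 2
          = f n ω ^ 2 + (2 * c * (f n ω * X (n + 1) ω) + c ^ 2 * X (n + 1) ω ^ 2) := by
        intro ω; rw [hfs]; ring
      have i1 := (hf2 n).integrable_sq
      have i2 := (hcross n).const_mul (2 * c)
      have i3 := (hXsq (n + 1) (by omega)).const_mul (c ^ 2)
      have i4 : Integrable
        (fun ω => 2 * c * (f n ω * X (n + 1) ω) + c ^ 2 * X (n + 1) ω ^ 2) μ := i2.add i3
      simp_rw [e1]
      rw [integral_add i1 i4, integral_add i2 i3, integral_const_mul, integral_const_mul,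
        hcross0, sum_range_succ, mul_add]
      have h1 := mul_le_mul_of_nonneg_left (hXL (n + 1) (by omega)) (sq_nonneg c)
      have h2 : 1 / ((n : ℝ) + 1) ^ 2 = c ^ 2 := by rw [hc, div_pow, one_pow]
      rw [h2]
      linarith
  have hsum : Summable fun t : ℕ => 1 / ((t : ℝ) + 1) ^ 2 := by
    have := (summable_nat_add_iff 1).2 (Real.summable_one_div_nat_pow.2 (by norm_num : 1 < 2))
    simpa using this
  set S : ℝ := ∑' t : ℕ, 1 / ((t : ℝ) + 1) ^ 2 with hS
  have hbdd : ∀ n, eLpNorm (f n) 1 μ ≤ ((1 + L * S).toNNReal : ℝ≥0∞) := by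
    intro n
    rw [eLpNorm_one_eq_lintegral_enorm, ← ofReal_integral_norm_eq_lintegral_enorm (hfint n)]
    refine ENNReal.ofReal_le_ofReal ?_
    have i1 := (hf2 n).integrable_sq
    have h1 : ∫ ω, ‖f n ω‖ ∂μ ≤ ∫ ω, (1 + f n ω ^ 2) ∂μ := by
      refine integral_mono (hfint n).norm ((integrable_const 1).add i1) fun ω => ?_
      simp only [Real.norm_eq_abs]
      nlinarith [sq_abs (f n ω), sq_nonneg (|f n ω| - 1), abs_nonneg (f n ω)]
    rw [integral_add (integrable_const 1) i1] at h1
    have h2 := hsum.sum_le_tsum (range n) (fun t _ => by positivity)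
    have h3 := mul_le_mul_of_nonneg_left h2 hL.le
    have h4 := hfsq n
    simp only [integral_const, probReal_univ, smul_eq_mul, mul_one] at h1
    linarith
  filter_upwards [hmart.submartingale.exists_ae_tendsto_of_bdd hbdd] with ω hω
  obtain ⟨m, hm⟩ := hω
  exact det_weighted (fun t => X t ω) a m ha0 ha1 hm
end

section
/- Let (X_n)_{n≥1} be a sequence of non-negative random variables on a probability space (Ω, F, P) converging almost surely to a random variable X_∞. If liminf_{n→∞} (E[X_n^n])^{1/n} = C < ∞, then X_∞ ≤ C almost surely. -/
open MeasureTheory Filter Finset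
open scoped ENNReal NNReal

/-- The Hubalek–Klein–Teichmann lemma: if non-negative random variables `X n`
converge a.s. to `X∞` and `liminf (E[X_n^n])^{1/n} = C < ∞`, then `X∞ ≤ C` a.s. -/
theorem liminf_nth_root_moment_bound
    {Ω : Type*} {m0 : MeasurableSpace Ω} (μ : Measure Ω) [IsProbabilityMeasure μ]
    (X : ℕ → Ω → ℝ) (Xinf : Ω → ℝ)
    (hmeas : ∀ n, AEMeasurable (X n) μ)
    (hnonneg : ∀ n, ∀ᵐ ω ∂μ, 0 ≤ X n ω)
    (hconv : ∀ᵐ ω ∂μ, Tendsto (fun n => X n ω) atTop (nhds (Xinf ω)))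
    (C : ℝ≥0∞) (hC : C ≠ ⊤)
    (hliminf : Filter.liminf
      (fun n : ℕ => (∫⁻ ω, ENNReal.ofReal (X n ω ^ n) ∂μ) ^ (1 / (n : ℝ))) atTop = C) :
    ∀ᵐ ω ∂μ, Xinf ω ≤ C.toReal := by
  have key : ∀ b : ℝ, C.toReal < b → ∀ᵐ ω ∂μ, Xinf ω ≤ b := by
    intro b hb
    have hb0 : 0 < b := lt_of_le_of_lt ENNReal.toReal_nonneg hb
    have hCb : C < ENNReal.ofReal b := (ENNReal.lt_ofReal_iff_toReal_lt hC).2 hb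
    obtain ⟨a, hCa, hab⟩ := exists_between hCb
    have hB0 : ENNReal.ofReal b ≠ 0 := by simpa using hb0
    have hBt : ENNReal.ofReal b ≠ ⊤ := ENNReal.ofReal_ne_top
    set r : ℝ≥0∞ := (ENNReal.ofReal b)⁻¹ with hr
    have hrt : r ≠ ⊤ := by simpa [hr] using hb0
    have hra : r * a < 1 := by
      rw [mul_comm, hr, ← div_eq_mul_inv]
      exact ENNReal.div_lt_of_lt_mul (by simpa using hab)
    have hfreq : ∃ᶠ n : ℕ in atTop,
        (∫⁻ ω, ENNReal.ofReal (X n ω ^ n) ∂μ) ^ (1 / (n : ℝ)) < a :=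
      frequently_lt_of_liminf_lt (by isBoundedDefault) (by rw [hliminf]; exact hCa)
    have hle : ∀ ε : ℝ≥0∞, 0 < ε →
        liminf (fun n : ℕ => ∫⁻ ω, r ^ n * ENNReal.ofReal (X n ω ^ n) ∂μ) atTop ≤ ε := by
      intro ε hε
      have hev := (ENNReal.tendsto_pow_atTop_nhds_zero_of_lt_one hra).eventually
        (gt_mem_nhds hε)
      refine liminf_le_of_frequently_le ?_ (by isBoundedDefault)
      refine (hfreq.and_eventually (hev.and (eventually_ge_atTop 1))).mono ?_
      rintro n ⟨h1, h2, h3⟩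
      have hn : (0 : ℝ) < n := by exact_mod_cast h3
      rw [lintegral_const_mul' _ _ (ENNReal.pow_ne_top hrt)]
      refine le_trans ?_ h2.le
      rw [mul_pow]
      gcongr
      rw [one_div] at h1
      have := (ENNReal.rpow_inv_le_iff hn).1 h1.le
      simpa using this
    have hzero : ∫⁻ ω, liminf (fun n : ℕ => r ^ n * ENNReal.ofReal (X n ω ^ n)) atTop ∂μ = 0 := by
      refine le_antisymm (le_trans (lintegral_liminf_le' fun n => ?_) ?_) bot_le
      · exact (((hmeas n).pow_const n).ennreal_ofReal).const_mul _
      · exact le_of_forall_gt_imp_ge_of_dense hle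
    have hmeas' : AEMeasurable
        (fun ω => liminf (fun n : ℕ => r ^ n * ENNReal.ofReal (X n ω ^ n)) atTop) μ := by
      simp only [liminf_eq_iSup_iInf_of_nat']
      exact AEMeasurable.iSup fun k => AEMeasurable.iInf fun n =>
        (((hmeas (n + k)).pow_const (n + k)).ennreal_ofReal).const_mul _
    have hae := (lintegral_eq_zero_iff' hmeas').1 hzero
    filter_upwards [hae, hconv] with ω h0 hc
    by_contra! hlt
    have hge : (1 : ℝ≥0∞) ≤
        liminf (fun n : ℕ => r ^ n * ENNReal.ofReal (X n ω ^ n)) atTop := by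
      refine le_liminf_of_le (by isBoundedDefault) ?_
      filter_upwards [hc.eventually (lt_mem_nhds hlt)] with n hn
      rw [ENNReal.ofReal_pow (hb0.trans hn).le, ← mul_pow]
      refine one_le_pow₀ ?_
      rw [← ENNReal.inv_mul_cancel hB0 hBt]
      gcongr
    rw [h0] at hge
    simp at hge
  have hall : ∀ᵐ ω ∂μ, ∀ k : ℕ, Xinf ω ≤ C.toReal + 1 / ((k : ℝ) + 1) :=
    ae_all_iff.2 fun k => key _ (lt_add_of_pos_right _ (by positivity))
  filter_upwards [hall] with ω h
  refine ge_of_tendsto' (x := atTop) ?_ h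
  simpa using tendsto_one_div_add_atTop_nhds_zero_nat.const_add C.toReal
end

section
/- Let (Ω, F, P) be a probability space with filtration (F_t)_{t∈ℕ}, and let (M_t)_{t≥0} be a positive adapted pricing kernel process with M_0 = 1, m_t = M_t/M_{t−1} integrable, and write the continuously compounded short rate as r_{f,t−1} = −log E[m_t | F_{t−1}]. Assume: (i) there exists L > 0 with E[(log m_t − E[log m_t | F_{t−1}])²] ≤ L for all t; (ii) the long-term entropy z_∞(m) = lim_{n→∞} (1/n) ∑_{t=1}^{n} (log E[m_t | F_{t−1}] − E[log m_t | F_{t−1}]) exists P-almost surely; and (iii) the long-term growth rate lim_{n→∞} (log M_n)/n exists P-almost surely. Then the long-term short rate r_{f,∞} = lim_{n→∞} (1/n) ∑_{t=1}^{n} r_{f,t−1} exists P-almost surely and satisfies r_{f,∞} = −z_∞(m) − lim_{n→∞} (log M_n)/n almost surely. -/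
open MeasureTheory Filter Finset
open scoped ENNReal NNReal

lemma kronecker_aux_s19 (d : ℕ → ℝ) (c : ℝ)
    (h : Tendsto (fun n => ∑ k ∈ Finset.range n, d k / ((k : ℝ) + 1)) atTop (nhds c)) :
    Tendsto (fun n : ℕ => (n : ℝ)⁻¹ * ∑ k ∈ Finset.range n, d k) atTop (nhds 0) := by
  have key : ∀ n : ℕ, ∑ k ∈ Finset.range n, d k
      = n * (∑ k ∈ Finset.range n, d k / ((k : ℝ) + 1))
        - ∑ j ∈ Finset.range n, ∑ k ∈ Finset.range j, d k / ((k : ℝ) + 1) := by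
    intro n
    induction n with
    | zero => simp
    | succ n ih =>
      have hn : (n : ℝ) + 1 ≠ 0 := by positivity
      have e : ((n : ℝ) + 1) * (d n / ((n : ℝ) + 1)) = d n := by field_simp
      rw [Finset.sum_range_succ, ih, Finset.sum_range_succ _ n, Finset.sum_range_succ _ n]
      push_cast
      rw [mul_add, e]
      ring
  have h2 := h.sub h.cesaro
  rw [sub_self] at h2
  refine h2.congr' ?_
  filter_upwards [eventually_gt_atTop 0] with n hn
  have hn' : (n : ℝ) ≠ 0 := by positivity
  rw [key n, mul_sub, inv_mul_cancel_left₀ hn']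

lemma mds_lln {Ω : Type*} {m0 : MeasurableSpace Ω} (μ : Measure Ω) [IsProbabilityMeasure μ]
    (ℱ : Filtration ℕ m0) (D : ℕ → Ω → ℝ) (L : ℝ)
    (hmeas : ∀ k, StronglyMeasurable[ℱ (k + 1)] (D k))
    (hL2 : ∀ k, MemLp (D k) 2 μ)
    (hvar : ∀ k, ∫ ω, D k ω ^ 2 ∂μ ≤ L)
    (hce : ∀ k, μ[D k | ℱ k] =ᵐ[μ] 0) :
    ∀ᵐ ω ∂μ, Tendsto (fun n : ℕ => (n : ℝ)⁻¹ * ∑ k ∈ Finset.range n, D k ω) atTop (nhds 0) := by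
  let S : ℕ → Ω → ℝ := fun n ω => ∑ k ∈ Finset.range n, D k ω / ((k : ℝ) + 1)
  have hSsucc : ∀ n, S (n + 1) = S n + fun ω => ((n : ℝ) + 1)⁻¹ * D n ω := by
    intro n
    ext ω
    simp only [S, Finset.sum_range_succ, Pi.add_apply]
    ring
  have hadp : StronglyAdapted ℱ S := by
    intro n
    refine Finset.stronglyMeasurable_fun_sum _ fun k hk => ?_
    have : StronglyMeasurable[ℱ n] (D k) :=
      (hmeas k).mono (ℱ.mono (Finset.mem_range.1 hk))
    simpa only [div_eq_mul_inv] using this.mul_const (((k : ℝ) + 1)⁻¹)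
  have hS2 : ∀ n, MemLp (S n) 2 μ := by
    intro n
    induction n with
    | zero => simp [S]
    | succ n ih =>
      rw [hSsucc]
      exact ih.add ((hL2 n).const_mul _)
  have hSint : ∀ n, Integrable (S n) μ := fun n => (hS2 n).integrable one_le_two
  have hDint : ∀ n, Integrable (D n) μ := fun n => (hL2 n).integrable one_le_two
  have hmart : Martingale S ℱ μ := by
    refine martingale_of_condExp_sub_eq_zero_nat hadp hSint fun n => ?_
    have : S (n + 1) - S n = ((n : ℝ) + 1)⁻¹ • D n := by
      rw [hSsucc, add_sub_cancel_left]
      rfl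
    rw [this]
    refine (condExp_smul _ _ _).trans ?_
    filter_upwards [hce n] with ω hω
    simp [hω]
  have horth : ∀ n, ∫ ω, S n ω * D n ω ∂μ = 0 := by
    intro n
    have hi : Integrable (S n * D n) μ := (hS2 n).integrable_mul (hL2 n)
    have h1 := condExp_mul_of_stronglyMeasurable_left (hadp n) hi (hDint n)
    have h2 : ∫ ω, (S n * D n) ω ∂μ = 0 := by
      rw [← integral_condExp (ℱ.le n)]
      refine integral_eq_zero_of_ae ?_
      filter_upwards [h1, hce n] with ω h h'
      simp [h, h']
    exact h2
  have hsq : ∀ n, ∫ ω, S n ω ^ 2 ∂μ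
      ≤ ∑ k ∈ Finset.range n, L * (1 / ((k : ℝ) + 1) ^ 2) := by
    intro n
    induction n with
    | zero => simp [S]
    | succ n ih =>
      have hi : Integrable (fun ω => S n ω * D n ω) μ := (hS2 n).integrable_mul (hL2 n)
      have e : ∫ ω, S (n + 1) ω ^ 2 ∂μ = ∫ ω, S n ω ^ 2 ∂μ
          + (2 * ((n : ℝ) + 1)⁻¹) * ∫ ω, S n ω * D n ω ∂μ
          + (((n : ℝ) + 1)⁻¹) ^ 2 * ∫ ω, D n ω ^ 2 ∂μ := by
        rw [← integral_const_mul, ← integral_const_mul, ← integral_add, ← integral_add]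
        · congr 1
          ext ω
          rw [hSsucc]
          simp only [Pi.add_apply]
          ring
        · exact (hS2 n).integrable_sq.add (hi.const_mul _)
        · exact (hL2 n).integrable_sq.const_mul _
        · exact (hS2 n).integrable_sq
        · exact hi.const_mul _
      rw [e, horth, Finset.sum_range_succ]
      have : (((n : ℝ) + 1)⁻¹) ^ 2 * ∫ ω, D n ω ^ 2 ∂μ ≤ (((n : ℝ) + 1)⁻¹) ^ 2 * L :=
        mul_le_mul_of_nonneg_left (hvar n) (by positivity)
      have e2 : L * (1 / ((n : ℝ) + 1) ^ 2) = (((n : ℝ) + 1)⁻¹) ^ 2 * L := by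
        rw [inv_pow, one_div, mul_comm]
      linarith
  have hL0 : 0 ≤ L := (integral_nonneg fun ω => sq_nonneg (D 0 ω)).trans (hvar 0)
  have hsum : Summable fun k : ℕ => L * (1 / ((k : ℝ) + 1) ^ 2) := by
    have := (summable_nat_add_iff 1).2 (Real.summable_one_div_nat_pow.2 one_lt_two)
    refine Summable.mul_left L ?_
    simpa using this
  set C : ℝ := ∑' k : ℕ, L * (1 / ((k : ℝ) + 1) ^ 2) with hC
  have hbound : ∀ n, ∫ ω, S n ω ^ 2 ∂μ ≤ C := fun n =>
    (hsq n).trans (hsum.sum_le_tsum _ fun k _ => by positivity)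
  have hbdd : ∀ n, eLpNorm (S n) 1 μ ≤ ((1 + C).toNNReal : ℝ≥0∞) := by
    intro n
    rw [eLpNorm_one_eq_lintegral_enorm, ← ofReal_integral_norm_eq_lintegral_enorm (hSint n)]
    refine ENNReal.ofReal_le_ofReal ?_
    calc ∫ ω, ‖S n ω‖ ∂μ ≤ ∫ ω, (1 + S n ω ^ 2) ∂μ := by
          refine integral_mono (hSint n).norm ((integrable_const _).add (hS2 n).integrable_sq) ?_
          intro ω
          simp only [Real.norm_eq_abs]
          nlinarith [sq_abs (S n ω), sq_nonneg (|S n ω| - 1), sq_nonneg (S n ω)]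
      _ = 1 + ∫ ω, S n ω ^ 2 ∂μ := by
          rw [integral_add (integrable_const _) (hS2 n).integrable_sq]; simp
      _ ≤ 1 + C := by linarith [hbound n]
  filter_upwards [hmart.submartingale.exists_ae_tendsto_of_bdd hbdd] with ω ⟨c, hc⟩
  exact kronecker_aux_s19 (fun k => D k ω) c hc

/-- Existence of the long-term short rate: if the long-term entropy `z∞(m)` of the
stochastic discount factors `m_t = M_t / M_{t-1}` and the long-term growth rate
`lim (log M_n)/n` exist a.s., then the long-term short rate
`r_{f,∞} = lim (1/n) ∑_{t=1}^n r_{f,t-1}` exists a.s. and equals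
`-z∞(m) - lim (log M_n)/n`, where `r_{f,t-1} = -log E[m_t | F_{t-1}]`. -/
theorem long_term_short_rate_exists
    {Ω : Type*} {m0 : MeasurableSpace Ω} (μ : Measure Ω) [IsProbabilityMeasure μ]
    (ℱ : Filtration ℕ m0) (M : ℕ → Ω → ℝ)
    (hadp : Adapted ℱ M)
    (hMpos : ∀ t, ∀ᵐ ω ∂μ, 0 < M t ω)
    (hM0 : ∀ ω, M 0 ω = 1)
    (hintm : ∀ t, Integrable (fun ω => M t ω / M (t - 1) ω) μ)
    (L : ℝ) (hL : 0 < L)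
    (hvar : ∀ t, 1 ≤ t →
      ∫⁻ ω, (‖Real.log (M t ω / M (t - 1) ω) -
        (μ[fun ω' => Real.log (M t ω' / M (t - 1) ω') | ℱ (t - 1)]) ω‖₊ : ℝ≥0∞) ^ 2 ∂μ
        ≤ ENNReal.ofReal L)
    (z : Ω → ℝ)
    (hz : ∀ᵐ ω ∂μ, Tendsto
      (fun n : ℕ => (1 / (n : ℝ)) * ∑ t ∈ Finset.Icc 1 n,
        (Real.log ((μ[fun ω' => M t ω' / M (t - 1) ω' | ℱ (t - 1)]) ω) -
          (μ[fun ω' => Real.log (M t ω' / M (t - 1) ω') | ℱ (t - 1)]) ω))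
      atTop (nhds (z ω)))
    (g : Ω → ℝ)
    (hg : ∀ᵐ ω ∂μ, Tendsto (fun n : ℕ => Real.log (M n ω) / (n : ℝ))
      atTop (nhds (g ω))) :
    ∀ᵐ ω ∂μ, Tendsto
      (fun n : ℕ => (1 / (n : ℝ)) * ∑ t ∈ Finset.Icc 1 n,
        (-(Real.log ((μ[fun ω' => M t ω' / M (t - 1) ω' | ℱ (t - 1)]) ω))))
      atTop (nhds (-z ω - g ω)) := by
  let X : ℕ → Ω → ℝ := fun k ω => Real.log (M (k + 1) ω / M k ω)
  let D : ℕ → Ω → ℝ := fun k ω => X k ω - (μ[X k | ℱ k]) ω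
  have hXm : ∀ k, Measurable[ℱ (k + 1)] (X k) := fun k =>
    Real.measurable_log.comp ((hadp (k + 1)).div ((hadp k).mono (ℱ.mono k.le_succ) le_rfl))
  have hDm : ∀ k, StronglyMeasurable[ℱ (k + 1)] (D k) := fun k =>
    (hXm k).stronglyMeasurable.sub (stronglyMeasurable_condExp.mono (ℱ.mono k.le_succ))
  have hDm0 : ∀ k, AEStronglyMeasurable (D k) μ := fun k =>
    ((hDm k).mono (ℱ.le _)).aestronglyMeasurable
  have hv : ∀ k, ∫⁻ ω, ‖D k ω‖ₑ ^ 2 ∂μ ≤ ENNReal.ofReal L := fun k =>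
    hvar (k + 1) (by omega)
  have hv' : ∀ k, ∫⁻ ω, ENNReal.ofReal (D k ω ^ 2) ∂μ ≤ ENNReal.ofReal L := fun k => by
    refine le_trans (le_of_eq ?_) (hv k)
    refine lintegral_congr fun ω => ?_
    rw [← sq_abs, ENNReal.ofReal_pow (abs_nonneg _), ← Real.norm_eq_abs, ofReal_norm]
  have hL2 : ∀ k, MemLp (D k) 2 μ := fun k => by
    rw [memLp_two_iff_integrable_sq (hDm0 k)]
    refine ⟨(hDm0 k).pow 2, ?_⟩
    rw [hasFiniteIntegral_iff_ofReal (ae_of_all _ fun ω => sq_nonneg _)]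
    exact (hv' k).trans_lt ENNReal.ofReal_lt_top
  have hvarD : ∀ k, ∫ ω, D k ω ^ 2 ∂μ ≤ L := fun k => by
    rw [integral_eq_lintegral_of_nonneg_ae (ae_of_all _ fun ω => sq_nonneg _) ((hDm0 k).pow 2)]
    exact ENNReal.toReal_le_of_le_ofReal hL.le (hv' k)
  have hXint : ∀ k, Integrable (X k) μ := fun k => by
    have := ((hL2 k).integrable one_le_two).add (integrable_condExp (f := X k) (m := ℱ k))
    refine this.congr (ae_of_all _ fun ω => ?_)
    simp [D]
  have hce : ∀ k, μ[D k | ℱ k] =ᵐ[μ] 0 := fun k => by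
    have h1 := condExp_sub (hXint k) (integrable_condExp (f := X k) (m := ℱ k) (μ := μ)) (ℱ k)
    have h2 : μ[μ[X k | ℱ k] | ℱ k] = μ[X k | ℱ k] :=
      condExp_of_stronglyMeasurable (ℱ.le k) stronglyMeasurable_condExp integrable_condExp
    rw [h2, sub_self] at h1
    exact h1
  filter_upwards [mds_lln μ ℱ D L hDm hL2 hvarD hce, hz, hg, ae_all_iff.2 hMpos]
    with ω hD hzω hgω hpos
  have hlog : ∀ n, Real.log (M n ω) = ∑ k ∈ Finset.range n, X k ω := by
    intro n
    induction n with
    | zero => simp [hM0]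
    | succ n ih =>
      rw [Finset.sum_range_succ, ← ih]
      simp only [X]
      rw [Real.log_div (hpos _).ne' (hpos _).ne']
      ring
  have hIcc : ∀ (f : ℕ → ℝ) (n : ℕ),
      ∑ t ∈ Finset.Icc 1 n, f t = ∑ k ∈ Finset.range n, f (k + 1) := by
    intro f n
    induction n with
    | zero => simp
    | succ n ih => rw [Finset.sum_Icc_succ_top (by omega), ih, Finset.sum_range_succ]
  have hfin := (hzω.neg.sub hgω).add hD
  rw [add_zero] at hfin
  refine hfin.congr fun n => ?_
  rw [hIcc, hIcc, hlog, one_div, div_eq_inv_mul]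
  rw [← mul_neg, ← mul_sub, ← mul_add, ← Finset.sum_neg_distrib, ← Finset.sum_sub_distrib,
    ← Finset.sum_add_distrib]
  congr 1
  refine Finset.sum_congr rfl fun k _ => ?_
  simp only [D, X, Nat.add_sub_cancel]
  ring
end
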